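/- Under the subcritically loaded scaling, for each i ∈ {1,…,C} one has λ^{(k)} α_i d_i / s_i^{(k)} → λϱ as k → ∞ (the per-class offered load converges to the fixed overall load λϱ; the quotient is well defined for all k large enough since s_i^{(k)} → ∞). -/

import Mathlib

open Finset Filter Topology MeasureTheory

/-- Erlang's loss formula (Erlang-B): blocking probability of an M/GI/s/s queue
with offered load `a`. -/
noncomputable def erlangB (s : ℕ) (a : ℝ) : ℝ :=
  (a ^ s / Nat.factorial s) / ∑ ℓ ∈ Finset.range (s + 1), a ^ ℓ / Nat.factorial ℓ

/-- Standard normal density φ. -/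
noncomputable def stdGaussianPDF (x : ℝ) : ℝ :=
  Real.exp (-x ^ 2 / 2) / Real.sqrt (2 * Real.pi)

/-- Standard normal cumulative distribution function Φ. -/
noncomputable def stdGaussianCDF (x : ℝ) : ℝ :=
  ∫ t in Set.Iic x, stdGaussianPDF t

/-- Relative demand of class `i`: ϱ_i = α_i d_i n_i. -/
noncomputable def relDemand {C : ℕ} (n : Fin C → ℕ) (α d : Fin C → ℝ) (i : Fin C) : ℝ :=
  α i * d i * n i

/-- Total relative demand: ϱ = ∑ i, ϱ_i. -/
noncomputable def totDemand {C : ℕ} (n : Fin C → ℕ) (α d : Fin C → ℝ) : ℝ :=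
  ∑ i, relDemand n α d i

/-- ψ_k = sup { x ∈ [0,1] : k - ∑_i ⌊x · k ϱ_i/(n_i f_k ϱ)⌋ n_i f_k ≥ max_i n_i f_k },
with the convention `sSup ∅ = 0` of real numbers. -/
noncomputable def psi {C : ℕ} (n : Fin C → ℕ) (α d : Fin C → ℝ) (f : ℕ → ℕ) (k : ℕ) : ℝ :=
  sSup {x : ℝ | x ∈ Set.Icc (0 : ℝ) 1 ∧
    (k : ℝ) - ∑ i, (⌊x * ((k : ℝ) * relDemand n α d i /
        ((n i : ℝ) * (f k : ℝ) * totDemand n α d))⌋ : ℝ) * ((n i : ℝ) * (f k : ℝ))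
      ≥ ((Finset.univ.sup (fun i => n i * f k) : ℕ) : ℝ)}

/-- Number of class-`i` "virtual servers": s_i^(k) = ⌊ψ_k · k ϱ_i/(n_i f_k ϱ)⌋. -/
noncomputable def srv {C : ℕ} (n : Fin C → ℕ) (α d : Fin C → ℝ) (f : ℕ → ℕ)
    (i : Fin C) (k : ℕ) : ℕ :=
  ⌊psi n α d f k * ((k : ℝ) * relDemand n α d i /
      ((n i : ℝ) * (f k : ℝ) * totDemand n α d))⌋₊

/-- θ_i = θ √(ϱ_i/(n_i ϱ)). -/
noncomputable def thetaI {C : ℕ} (n : Fin C → ℕ) (α d : Fin C → ℝ) (θ : ℝ) (i : Fin C) : ℝ :=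
  θ * Real.sqrt (relDemand n α d i / ((n i : ℝ) * totDemand n α d))

/-- The total relative demand is positive as soon as there is a class. -/
lemma totDemand_pos {C : ℕ} {n : Fin C → ℕ} (hn : ∀ i, 0 < n i) {α d : Fin C → ℝ}
    (hα : ∀ i, 0 < α i) (hd : ∀ i, 0 < d i) (i : Fin C) : 0 < totDemand n α d := by
  refine Finset.sum_pos (fun j _ => ?_) ⟨i, Finset.mem_univ i⟩
  have := hα j
  have := hd j
  have : (0 : ℝ) < n j := by exact_mod_cast hn j
  unfold relDemand
  positivity

lemma psi_le_one {C : ℕ} (n : Fin C → ℕ) (α d : Fin C → ℝ) (f : ℕ → ℕ) (k : ℕ) :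
    psi n α d f k ≤ 1 :=
  Real.sSup_le (fun _ hx => hx.1.2) zero_le_one

/-- The point `1 - max_i n_i f_k / k` is admissible in the supremum defining `ψ_k`,
whenever it is nonnegative. -/
lemma one_sub_le_psi {C : ℕ} {n : Fin C → ℕ} (hn : ∀ i, 0 < n i) {α d : Fin C → ℝ}
    (hϱ : 0 < totDemand n α d) {f : ℕ → ℕ} {k : ℕ} (hf : 0 < f k) (hk : 0 < k) :
    1 - ((Finset.univ.sup n : ℕ) : ℝ) * ((f k : ℝ) / k) ≤ psi n α d f k := by
  set N : ℕ := Finset.univ.sup n with hN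
  have hk' : (0 : ℝ) < k := by exact_mod_cast hk
  have hf' : (0 : ℝ) < f k := by exact_mod_cast hf
  set x : ℝ := 1 - (N : ℝ) * ((f k : ℝ) / k) with hx
  rcases lt_or_ge x 0 with h0 | h0
  · exact h0.le.trans (Real.sSup_nonneg fun _ hy => hy.1.1)
  have hx1 : x ≤ 1 := sub_le_self _ (by positivity)
  refine le_csSup ⟨1, fun _ hy => hy.1.2⟩ ⟨⟨h0, hx1⟩, ?_⟩
  have hsup : ((Finset.univ.sup (fun i => n i * f k) : ℕ) : ℝ) ≤ (N : ℝ) * f k := by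
    have : Finset.univ.sup (fun i => n i * f k) ≤ N * f k :=
      Finset.sup_le fun i hi => Nat.mul_le_mul_right _ (Finset.le_sup hi)
    exact_mod_cast this
  have hsum : ∑ i, (⌊x * ((k : ℝ) * relDemand n α d i /
      ((n i : ℝ) * (f k : ℝ) * totDemand n α d))⌋ : ℝ) * ((n i : ℝ) * (f k : ℝ)) ≤ x * k := by
    calc _ ≤ ∑ i, x * k / totDemand n α d * relDemand n α d i := by
          refine Finset.sum_le_sum fun i _ => ?_
          have hni : (0 : ℝ) < n i := by exact_mod_cast hn i
          refine (mul_le_mul_of_nonneg_right (Int.floor_le _) (by positivity)).trans_eq ?_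
          field_simp
      _ = x * k := by
          rw [← Finset.mul_sum]
          exact div_mul_cancel₀ _ hϱ.ne'
  have hxk : x * k = k - N * f k := by
    rw [hx]
    field_simp
  linarith

lemma tendsto_psi {C : ℕ} {n : Fin C → ℕ} (hn : ∀ i, 0 < n i) {α d : Fin C → ℝ}
    (hϱ : 0 < totDemand n α d) {f : ℕ → ℕ} (hf : ∀ k, 0 < f k)
    (hfk : Tendsto (fun k : ℕ => (f k : ℝ) / k) atTop (𝓝 0)) :
    Tendsto (psi n α d f) atTop (𝓝 1) := by
  have hlow : Tendsto (fun k : ℕ => 1 - ((Finset.univ.sup n : ℕ) : ℝ) * ((f k : ℝ) / k))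
      atTop (𝓝 1) := by
    simpa using (hfk.const_mul ((Finset.univ.sup n : ℕ) : ℝ)).const_sub 1
  refine tendsto_of_tendsto_of_tendsto_of_le_of_le' hlow tendsto_const_nhds ?_
    (Eventually.of_forall (psi_le_one n α d f))
  filter_upwards [eventually_gt_atTop 0] with k hk
  exact one_sub_le_psi hn hϱ (hf k) hk

/-- If `u → 1` and `v → ∞`, then `⌊u v⌋ / v → 1`. -/
lemma tendsto_natFloor_mul_div {ι : Type*} {l : Filter ι} {u v : ι → ℝ}
    (hu : Tendsto u l (𝓝 1)) (hv : Tendsto v l atTop) :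
    Tendsto (fun k => (⌊u k * v k⌋₊ : ℝ) / v k) l (𝓝 1) := by
  have h := (tendsto_nat_floor_div_atTop.comp (hu.pos_mul_atTop one_pos hv)).mul hu
  rw [one_mul] at h
  refine h.congr' ?_
  filter_upwards [hu.eventually_const_lt zero_lt_one, hv.eventually_gt_atTop 0] with k h1 h2
  have := h1.ne'
  simp only [Function.comp_apply]
  field_simp

/-- In the subcritically loaded regime, the per-class offered load converges to
the fixed overall load λϱ. -/
theorem subcritical_class_load
    (C : ℕ) (hC : 0 < C) (n : Fin C → ℕ) (hn : ∀ i, 0 < n i)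
    (α d : Fin C → ℝ) (hα : ∀ i, 0 < α i) (hd : ∀ i, 0 < d i)
    (hsum : ∑ i, α i = 1)
    (f : ℕ → ℕ) (hf : ∀ k, 0 < f k)
    (hfk : Tendsto (fun k : ℕ => (f k : ℝ) / k) atTop (𝓝 0))
    (lam : ℝ) (hlam : 0 < lam) (hsub : lam * totDemand n α d < 1)
    (i : Fin C) :
    Tendsto
      (fun k : ℕ => lam * k / f k * α i * d i / (srv n α d f i k : ℝ))
      atTop (𝓝 (lam * totDemand n α d)) := by
  have hϱ := totDemand_pos hn hα hd i
  have hni : (0 : ℝ) < n i := by exact_mod_cast hn i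
  have hαd : 0 < α i * d i / totDemand n α d := div_pos (mul_pos (hα i) (hd i)) hϱ
  set v : ℕ → ℝ := fun k => (k : ℝ) * relDemand n α d i /
    ((n i : ℝ) * (f k : ℝ) * totDemand n α d) with hv
  have hv_eq : ∀ k, v k = α i * d i / totDemand n α d * ((f k : ℝ) / k)⁻¹ := fun k => by
    have : (0 : ℝ) < f k := by exact_mod_cast hf k
    simp only [hv, relDemand, inv_div]
    field_simp
  have hv_top : Tendsto v atTop atTop := by
    simp only [funext hv_eq]
    refine Tendsto.const_mul_atTop hαd (Tendsto.inv_tendsto_nhdsGT_zero ?_)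
    refine tendsto_nhdsWithin_iff.2 ⟨hfk, ?_⟩
    filter_upwards [eventually_gt_atTop 0] with k hk
    have : (0 : ℝ) < k := by exact_mod_cast hk
    have : (0 : ℝ) < f k := by exact_mod_cast hf k
    exact Set.mem_Ioi.2 (by positivity)
  have h := ((tendsto_natFloor_mul_div (tendsto_psi hn hϱ hf hfk) hv_top).inv₀
    one_ne_zero).const_mul (lam * totDemand n α d)
  rw [inv_one, mul_one] at h
  refine h.congr fun k => ?_
  change lam * totDemand n α d * ((srv n α d f i k : ℝ) / v k)⁻¹ = _
  rw [inv_div, ← mul_div_assoc, hv_eq, inv_div]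
  congr 1
  field_simp
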